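/- There is a universal constant C > 0 with the following property. For every n ≥ 1, every h > 0, every ε ∈ (0,h], and every γ ∈ (0,1), there exists a function A mapping every sequence of m value profiles in [0,h]ⁿ to a measurable DSIC and IR mechanism such that: for every product Borel probability distribution D on [0,h]ⁿ, if m ≥ C·h²·ε^{−2}·(n·h·ε^{−1}·log(nh/ε) + log(1/γ)), then with probability at least 1−γ over m i.i.d. samples v₁,…,v_m from D, Rev(A(v₁,…,v_m), D) ≥ Opt(D) − C·ε. -/

import Mathlib

open MeasureTheory

/-- A (direct-revelation) mechanism for `n` buyers and one item: an allocation
rule and a payment rule on value profiles. -/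
structure Mech (n : ℕ) where
  alloc : (Fin n → ℝ) → Fin n → ℝ
  pay : (Fin n → ℝ) → Fin n → ℝ

/-- Allocation probabilities are in `[0,1]` and sum to at most `1`. -/
def Mech.Valid {n : ℕ} (M : Mech n) : Prop :=
  ∀ v : Fin n → ℝ, (∀ i, 0 ≤ M.alloc v i ∧ M.alloc v i ≤ 1) ∧ ∑ i, M.alloc v i ≤ 1

/-- Dominant strategy incentive compatibility (on nonnegative value profiles). -/
def Mech.DSIC {n : ℕ} (M : Mech n) : Prop :=
  ∀ (i : Fin n) (v : Fin n → ℝ), (∀ j, 0 ≤ v j) → ∀ v' : ℝ, 0 ≤ v' →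
    v i * M.alloc (Function.update v i v') i - M.pay (Function.update v i v') i ≤
      v i * M.alloc v i - M.pay v i

/-- Individual rationality (on nonnegative value profiles). -/
def Mech.IR {n : ℕ} (M : Mech n) : Prop :=
  ∀ v : Fin n → ℝ, (∀ j, 0 ≤ v j) → ∀ i, 0 ≤ v i * M.alloc v i - M.pay v i

/-- Measurability of the allocation and payment rules. -/
def Mech.Meas {n : ℕ} (M : Mech n) : Prop :=
  (∀ i, Measurable fun v => M.alloc v i) ∧ (∀ i, Measurable fun v => M.pay v i)

/-- A measurable DSIC and IR mechanism. -/
def Mech.Good {n : ℕ} (M : Mech n) : Prop := M.Valid ∧ M.DSIC ∧ M.IR ∧ M.Meas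

/-- Expected revenue of mechanism `M` on value distribution `D`. -/
noncomputable def Rev {n : ℕ} (M : Mech n) (D : Measure (Fin n → ℝ)) : ℝ :=
  ∫ v, ∑ i, M.pay v i ∂D

/-- Optimal revenue: supremum of revenue over measurable DSIC and IR mechanisms. -/
noncomputable def Opt {n : ℕ} (D : Measure (Fin n → ℝ)) : ℝ :=
  sSup {r : ℝ | ∃ M : Mech n, M.Good ∧ r = Rev M D}



theorem iso_minimizer (K : ℕ) (q ψ : ℕ → ℝ) (B : ℝ) (hB : 0 ≤ B) (hq : ∀ k, 0 ≤ q k)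
    (hψ : ∀ k ∈ Finset.range (K + 1), ψ k ≤ q k * B) :
    ∃ y : ℕ → ℝ, Monotone y ∧ (∀ k, 0 ≤ y k) ∧ (∀ k, y k ≤ B) ∧
      ∀ z : ℕ → ℝ, Monotone z → (∀ k, 0 ≤ z k) →
        ∑ k ∈ Finset.range (K + 1), (q k * y k ^ 2 / 2 - ψ k * y k) ≤
        ∑ k ∈ Finset.range (K + 1), (q k * z k ^ 2 / 2 - ψ k * z k) := by
  set S : Set (ℕ → ℝ) := {y | Monotone y} ∩ Set.pi Set.univ (fun _ => Set.Icc 0 B) with hS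
  have hc : IsCompact S := by
    apply IsCompact.inter_left
    · exact isCompact_univ_pi (fun _ => isCompact_Icc)
    · have : {y : ℕ → ℝ | Monotone y} = ⋂ (a : ℕ) (b : ℕ) (_ : a ≤ b), {y | y a ≤ y b} := by
        ext y; simp [Monotone]
      rw [this]
      refine isClosed_iInter fun a => isClosed_iInter fun b => isClosed_iInter fun _ => ?_
      exact isClosed_le (continuous_apply a) (continuous_apply b)
  have hne : S.Nonempty := ⟨fun _ => 0, monotone_const, fun _ _ => ⟨le_rfl, hB⟩⟩
  obtain ⟨y, hy, hmin⟩ := hc.exists_isMinOn hne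
    (f := fun y : ℕ → ℝ => ∑ k ∈ Finset.range (K + 1), (q k * y k ^ 2 / 2 - ψ k * y k))
    (by fun_prop)
  refine ⟨y, hy.1, fun k => (hy.2 k trivial).1, fun k => (hy.2 k trivial).2, fun z hz hz0 => ?_⟩
  have h1 : (fun k => min (z k) B) ∈ S := by
    refine ⟨fun a b hab => min_le_min_right _ (hz hab), fun k _ => ⟨le_min (hz0 k) hB, min_le_right _ _⟩⟩
  refine (hmin h1).trans ?_
  apply Finset.sum_le_sum
  intro k hk
  rcases le_total (z k) B with h | h
  · simp [min_eq_left h]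
  · simp only [min_eq_right h]
    have := hψ k hk
    nlinarith [mul_nonneg (sub_nonneg.2 this) (sub_nonneg.2 h),
      mul_nonneg (hq k) (sq_nonneg (z k - B))]

theorem quad_first_order (a b : ℝ) (s₀ : ℝ) (hs₀ : 0 < s₀)
    (h : ∀ s, 0 < s → s ≤ s₀ → 0 ≤ s * a + s ^ 2 * b) : 0 ≤ a := by
  by_contra! hn
  have hb : 0 < |b| + 1 := by positivity
  set s := min s₀ (-a / (2 * (|b| + 1))) with hs
  have hspos : 0 < s := lt_min hs₀ (div_pos (by linarith) (by positivity))
  have h1 := h s hspos (min_le_left _ _)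
  have h2 : s * (2 * (|b| + 1)) ≤ -a := by
    rw [← le_div_iff₀ (by positivity)]; exact min_le_right _ _
  have h3 : 0 ≤ a + s * b := by
    by_contra! hc
    nlinarith
  have h4 : s * b ≤ s * |b| := mul_le_mul_of_nonneg_left (le_abs_self b) hspos.le
  nlinarith

theorem isotonic (K : ℕ) (q ψ : ℕ → ℝ) (B : ℝ) (hB : 0 ≤ B) (hq : ∀ k, 0 ≤ q k)
    (hψ : ∀ k ∈ Finset.range (K + 1), ψ k ≤ q k * B) :
    ∃ y : ℕ → ℝ, Monotone y ∧ (∀ k, 0 ≤ y k) ∧ (∀ k, y k ≤ B) ∧ (∀ k, y k = y (min k K)) ∧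
      (∀ x : ℕ → ℝ, Monotone x → (∀ k, 0 ≤ x k) →
        ∑ k ∈ Finset.range (K + 1), ψ k * x k ≤ ∑ k ∈ Finset.range (K + 1), q k * y k * x k) ∧
      (∀ x : ℕ → ℝ, Monotone x → (∀ k, 0 ≤ x k) →
        (∃ s : ℝ, 0 < s ∧ ∀ j k, y j < y k → s ≤ y k - y j) → 
        (∃ s : ℝ, 0 < s ∧ ∀ k, x k ≠ 0 → s ≤ y k) →
        (∀ k, x k = 0 ∨ x k = 1) → (∀ j k, x j = 0 → x k = 1 → y j < y k) →
        ∑ k ∈ Finset.range (K + 1), q k * y k * x k ≤ ∑ k ∈ Finset.range (K + 1), ψ k * x k) := by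
  obtain ⟨y, hy, hy0, hyB, hmin⟩ := iso_minimizer K q ψ B hB hq hψ
  have hyc : ∀ k ∈ Finset.range (K + 1), y (min k K) = y k := by
    intro k hk
    rw [min_eq_left (by simp at hk; omega)]
  have hmin' : ∀ z : ℕ → ℝ, Monotone z → (∀ k, 0 ≤ z k) →
        ∑ k ∈ Finset.range (K + 1), (q k * y (min k K) ^ 2 / 2 - ψ k * y (min k K)) ≤
        ∑ k ∈ Finset.range (K + 1), (q k * z k ^ 2 / 2 - ψ k * z k) := by
    intro z hz hz0
    refine le_trans (le_of_eq (Finset.sum_congr rfl fun k hk => by rw [hyc k hk])) (hmin z hz hz0)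
  have hY : Monotone fun k => y (min k K) := fun a b hab => hy (min_le_min_right _ hab)
  refine ⟨fun k => y (min k K), hY, fun k => hy0 _, fun k => hyB _,
    fun k => by simp, ?_, ?_⟩
  · intro x hx hx0
    have := quad_first_order (∑ k ∈ Finset.range (K + 1), (q k * y (min k K) * x k - ψ k * x k))
      (∑ k ∈ Finset.range (K + 1), q k * x k ^ 2 / 2) 1 one_pos ?_
    · rw [Finset.sum_sub_distrib] at this
      linarith
    · intro s hs _
      have h1 := hmin' (fun k => y (min k K) + s * x k)
        (hY.add (hx.const_mul hs.le))
        (fun k => add_nonneg (hy0 _) (mul_nonneg hs.le (hx0 k)))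
      rw [← sub_nonneg, ← Finset.sum_sub_distrib] at h1
      rw [Finset.mul_sum, Finset.mul_sum, ← Finset.sum_add_distrib]
      refine h1.trans (le_of_eq (Finset.sum_congr rfl fun k _ => by ring))
  · intro x hx hx0 ⟨s₁, hs₁, hd⟩ ⟨s₂, hs₂, he⟩ h01 hlt
    have := quad_first_order (∑ k ∈ Finset.range (K + 1), (ψ k * x k - q k * y (min k K) * x k))
      (∑ k ∈ Finset.range (K + 1), q k * x k ^ 2 / 2) (min s₁ s₂) (lt_min hs₁ hs₂) ?_
    · rw [Finset.sum_sub_distrib] at this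
      linarith
    · intro s hs hss
      have h1 := hmin' (fun k => y (min k K) - s * x k) ?_ ?_
      · rw [← sub_nonneg, ← Finset.sum_sub_distrib] at h1
        rw [Finset.mul_sum, Finset.mul_sum, ← Finset.sum_add_distrib]
        refine h1.trans (le_of_eq (Finset.sum_congr rfl fun k _ => by ring))
      · intro a b hab
        have hxab := hx hab
        have hyab := hY hab
        dsimp only at hyab ⊢
        rcases h01 a with ha | ha <;> rcases h01 b with hb | hb
        · rw [ha, hb]; linarith
        · have := hd _ _ (hlt a b ha hb)
          rw [ha, hb]
          have := hss.trans (min_le_left _ _)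
          linarith
        · rw [ha, hb] at hxab; linarith
        · rw [ha, hb]; linarith
      · intro k
        rcases h01 k with hk | hk
        · simp [hk, hy0]
        · have := he k (by simp [hk])
          have := hss.trans (min_le_right _ _)
          simp only [hk]
          linarith

theorem abel_psi (K : ℕ) (ε : ℝ) (q x : ℕ → ℝ) :
    ∑ k ∈ Finset.range (K + 1), q k * (k * ε * x k - ε * ∑ l ∈ Finset.range k, x l) =
    ∑ k ∈ Finset.range (K + 1),
      (k * ε * q k - ε * ∑ j ∈ Finset.Ico (k + 1) (K + 1), q j) * x k := by
  have h : ∑ k ∈ Finset.range (K + 1), ∑ l ∈ Finset.range k, q k * x l =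
    ∑ l ∈ Finset.range (K + 1), ∑ k ∈ Finset.Ico (l + 1) (K + 1), q k * x l := by
    apply Finset.sum_comm'
    intro a b
    simp only [Finset.mem_range, Finset.mem_Ico]
    omega
  have e1 : ∀ k, q k * (k * ε * x k - ε * ∑ l ∈ Finset.range k, x l) =
      q k * k * ε * x k - ε * ∑ l ∈ Finset.range k, q k * x l := by
    intro k; rw [← Finset.mul_sum]; ring
  have e2 : ∀ k, (k * ε * q k - ε * ∑ j ∈ Finset.Ico (k + 1) (K + 1), q j) * x k =
      q k * k * ε * x k - ε * ∑ j ∈ Finset.Ico (k + 1) (K + 1), q j * x k := by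
    intro k; rw [← Finset.sum_mul]; ring
  simp only [e1, e2, Finset.sum_sub_distrib]
  rw [← Finset.mul_sum, ← Finset.mul_sum, h]

/-- index of the grid cell of a value -/
noncomputable def cellOf (ε t : ℝ) : ℕ := ⌊t / ε⌋₊

theorem measurable_cellOf (ε : ℝ) : Measurable (cellOf ε) :=
  Nat.measurable_floor.comp (measurable_id.div_const ε)

theorem measurableSet_cell (ε : ℝ) (k : ℕ) : MeasurableSet {t | cellOf ε t = k} :=
  measurable_cellOf ε (measurableSet_singleton k)

theorem cellOf_mul_le {ε t : ℝ} (hε : 0 < ε) (ht : 0 ≤ t) : (cellOf ε t : ℝ) * ε ≤ t := by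
  have := Nat.floor_le (div_nonneg ht hε.le)
  rwa [le_div_iff₀ hε] at this

theorem lt_cellOf_mul {ε t : ℝ} (hε : 0 < ε) : t < ((cellOf ε t : ℝ) + 1) * ε := by
  have := Nat.lt_floor_add_one (t / ε)
  rwa [div_lt_iff₀ hε] at this

theorem cellOf_le {ε t h : ℝ} (hε : 0 < ε) (ht : t ≤ h) : cellOf ε t ≤ cellOf ε h :=
  Nat.floor_le_floor (div_le_div_of_nonneg_right ht hε.le)

/-- mass of cell `k` -/
noncomputable def cellMass (μ : Measure ℝ) (ε : ℝ) (k : ℕ) : ℝ := μ.real {t | cellOf ε t = k}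

/-- mass-weighted virtual value of cell `k` -/
noncomputable def cellPsi (μ : Measure ℝ) (ε : ℝ) (K k : ℕ) : ℝ :=
  k * ε * cellMass μ ε k - ε * ∑ j ∈ Finset.Ico (k + 1) (K + 1), cellMass μ ε j

theorem cellMass_nonneg (μ : Measure ℝ) (ε : ℝ) (k : ℕ) : 0 ≤ cellMass μ ε k := measureReal_nonneg

theorem cellPsi_le (μ : Measure ℝ) {ε h : ℝ} (hε : 0 < ε) (hh : 0 ≤ h) (k : ℕ)
    (hk : k ∈ Finset.range (cellOf ε h + 1)) :
    cellPsi μ ε (cellOf ε h) k ≤ cellMass μ ε k * h := by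
  have h1 : (k : ℝ) * ε ≤ h := by
    refine le_trans ?_ (cellOf_mul_le hε hh)
    have : (k : ℝ) ≤ cellOf ε h := by
      simp only [Finset.mem_range] at hk
      exact_mod_cast (by omega : k ≤ cellOf ε h)
    exact mul_le_mul_of_nonneg_right this hε.le
  have h2 : 0 ≤ ε * ∑ j ∈ Finset.Ico (k + 1) (cellOf ε h + 1), cellMass μ ε j :=
    mul_nonneg hε.le (Finset.sum_nonneg fun j _ => cellMass_nonneg _ _ _)
  have := mul_le_mul_of_nonneg_right h1 (cellMass_nonneg μ ε k)
  unfold cellPsi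
  linarith

theorem ae_mem_Icc {μ : Measure ℝ} {h : ℝ} (hμ : μ (Set.Icc 0 h)ᶜ = 0) :
    ∀ᵐ t ∂μ, t ∈ Set.Icc 0 h := hμ

theorem integral_split_cells {μ : Measure ℝ} {ε h : ℝ} (hε : 0 < ε)
    (hμ : μ (Set.Icc 0 h)ᶜ = 0) {f : ℝ → ℝ} (hf : Integrable f μ) :
    ∫ t, f t ∂μ = ∑ k ∈ Finset.range (cellOf ε h + 1), ∫ t in {t | cellOf ε t = k}, f t ∂μ := by
  rw [← integral_biUnion_finset]
  · rw [← setIntegral_univ]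
    apply setIntegral_congr_set
    rw [Filter.eventuallyEq_set]
    filter_upwards [ae_mem_Icc hμ] with t ht
    have := cellOf_le hε ht.2
    simp
    omega
  · exact fun k _ => measurableSet_cell ε k
  · intro a _ b _ hab
    rw [Function.onFun, Set.disjoint_left]
    intro t (h1 : _ = _) (h2 : _ = _)
    exact hab (h1.symm.trans h2)
  · exact fun k _ => hf.integrableOn

theorem integrable_cell {μ : Measure ℝ} [IsProbabilityMeasure μ] {ε h : ℝ} (hε : 0 < ε)
    (hμ : μ (Set.Icc 0 h)ᶜ = 0) (g : ℕ → ℝ) : Integrable (fun t => g (cellOf ε t)) μ := by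
  refine Integrable.of_bound (C := ∑ k ∈ Finset.range (cellOf ε h + 1), |g k|) ?_ ?_
  · exact (Measurable.of_discrete.comp (measurable_cellOf ε)).aestronglyMeasurable
  · filter_upwards [ae_mem_Icc hμ] with t ht
    have := cellOf_le hε ht.2
    exact Finset.single_le_sum (f := fun k => |g k|) (fun k _ => abs_nonneg _)
      (Finset.mem_range.2 (by omega))

theorem integral_cell {μ : Measure ℝ} [IsProbabilityMeasure μ] {ε h : ℝ} (hε : 0 < ε)
    (hμ : μ (Set.Icc 0 h)ᶜ = 0) (g : ℕ → ℝ) :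
    ∫ t, g (cellOf ε t) ∂μ = ∑ k ∈ Finset.range (cellOf ε h + 1), cellMass μ ε k * g k := by
  rw [integral_split_cells hε hμ (integrable_cell hε hμ g)]
  refine Finset.sum_congr rfl fun k _ => ?_
  have : ∫ t in {t | cellOf ε t = k}, g (cellOf ε t) ∂μ = ∫ t in {t | cellOf ε t = k}, g k ∂μ :=
    setIntegral_congr_fun (measurableSet_cell ε k) (fun t (ht : _ = _) => by simp only [ht])
  rw [this, setIntegral_const, smul_eq_mul]
  rfl

/-- The one-dimensional Myerson bound. -/
theorem one_dim_upper {μ : Measure ℝ} [IsProbabilityMeasure μ] {ε h : ℝ} (hε : 0 < ε)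
    (hμ : μ (Set.Icc 0 h)ᶜ = 0) (y : ℕ → ℝ)
    (hy : ∀ X : ℕ → ℝ, Monotone X → (∀ k, 0 ≤ X k) →
        ∑ k ∈ Finset.range (cellOf ε h + 1), cellPsi μ ε (cellOf ε h) k * X k ≤
        ∑ k ∈ Finset.range (cellOf ε h + 1), cellMass μ ε k * y k * X k)
    (x : ℝ → ℝ) (hxm : Measurable x) (hx0 : ∀ t, 0 ≤ x t) (hx1 : ∀ t, x t ≤ 1)
    (hmono : ∀ s t, 0 ≤ s → s ≤ t → x s ≤ x t) :
    ∫ t, (t * x t - ε * ∑ l ∈ Finset.range (cellOf ε t), x (l * ε)) ∂μ ≤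
      ∫ t, (y (cellOf ε t) + 2 * ε) * x t ∂μ := by
  have hxint : Integrable x μ := Integrable.of_bound (C := 1) hxm.aestronglyMeasurable
    (Filter.Eventually.of_forall fun t => by rw [Real.norm_eq_abs, abs_of_nonneg (hx0 t)]; exact hx1 t)
  have hInteg1 : Integrable (fun t => t * x t) μ := by
    refine Integrable.of_bound (C := h) (measurable_id.mul hxm).aestronglyMeasurable ?_
    filter_upwards [ae_mem_Icc hμ] with t ht
    rw [Real.norm_eq_abs, abs_of_nonneg (mul_nonneg ht.1 (hx0 t))]
    exact (mul_le_of_le_one_right ht.1 (hx1 t)).trans ht.2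
  have hInteg2 := integrable_cell hε hμ (fun k => ε * ∑ l ∈ Finset.range k, x (l * ε))
  have hIntegL : Integrable
      (fun t => t * x t - ε * ∑ l ∈ Finset.range (cellOf ε t), x (l * ε)) μ := hInteg1.sub hInteg2
  have hIntegR : Integrable (fun t => (y (cellOf ε t) + 2 * ε) * x t) μ := by
    have := integrable_cell hε hμ (fun k => y k + 2 * ε)
    exact this.mul_bdd (c := 1) hxm.aestronglyMeasurable
      (Filter.Eventually.of_forall fun t => by
        rw [Real.norm_eq_abs, abs_of_nonneg (hx0 t)]; exact hx1 t)
  rw [integral_split_cells hε hμ hIntegL, integral_split_cells hε hμ hIntegR]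
  set q := cellMass μ ε with hq
  have hq0 : ∀ k, 0 ≤ q k := fun k => cellMass_nonneg _ _ _
  set I : ℕ → ℝ := fun k => ∫ t in {t | cellOf ε t = k}, x t ∂μ with hI
  set X : ℕ → ℝ := fun k => if q k = 0 then x (k * ε) else I k / q k with hX
  have hae : ∀ k : ℕ, ∀ᵐ t ∂μ.restrict {t | cellOf ε t = k}, cellOf ε t = k ∧ 0 ≤ t := by
    intro k
    filter_upwards [ae_restrict_mem (measurableSet_cell ε k), ae_restrict_of_ae (ae_mem_Icc hμ)]
      with t h1 h2 using ⟨h1, h2.1⟩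
  have hIlo : ∀ k, q k * x (k * ε) ≤ I k := by
    intro k
    have : ∫ t in {t | cellOf ε t = k}, x (k * ε) ∂μ ≤ I k := by
      apply integral_mono_ae (integrable_const _) hxint.integrableOn
      filter_upwards [hae k] with t ht
      apply hmono _ _ (by positivity)
      rw [← ht.1]; exact cellOf_mul_le hε ht.2
    rwa [setIntegral_const, smul_eq_mul] at this
  have hIhi : ∀ k : ℕ, I k ≤ q k * x ((k + 1 : ℕ) * ε) := by
    intro k
    have : I k ≤ ∫ t in {t | cellOf ε t = k}, x ((k + 1 : ℕ) * ε) ∂μ := by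
      apply integral_mono_ae hxint.integrableOn (integrable_const _)
      filter_upwards [hae k] with t ht
      apply hmono _ _ ht.2
      have := lt_cellOf_mul (t := t) hε
      rw [ht.1] at this
      push_cast
      exact this.le
    rwa [setIntegral_const, smul_eq_mul] at this
  have hqX : ∀ k, q k * X k = I k := by
    intro k
    simp only [hX]
    split_ifs with h0
    · have h1 := hIlo k
      have h2 := hIhi k
      rw [h0] at h1 h2 ⊢
      linarith
    · field_simp
  have hXlo : ∀ k : ℕ, x (k * ε) ≤ X k := by
    intro k
    simp only [hX]
    split_ifs with h0
    · exact le_rfl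
    · rw [le_div_iff₀ (lt_of_le_of_ne (hq0 k) (Ne.symm h0))]
      linarith [hIlo k]
  have hXhi : ∀ k : ℕ, X k ≤ x ((k + 1 : ℕ) * ε) := by
    intro k
    simp only [hX]
    split_ifs with h0
    · apply hmono _ _ (by positivity)
      push_cast; nlinarith
    · rw [div_le_iff₀ (lt_of_le_of_ne (hq0 k) (Ne.symm h0))]
      linarith [hIhi k]
  have hXmono : Monotone X := monotone_nat_of_le_succ fun k => (hXhi k).trans (hXlo (k + 1))
  have hX0 : ∀ k, 0 ≤ X k := fun k => (hx0 _).trans (hXlo k)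
  have hsum : ∀ k : ℕ, ∑ l ∈ Finset.range k, X l - X k ≤ ∑ l ∈ Finset.range k, x (l * ε) := by
    intro k
    have : ∀ j : ℕ, ∑ l ∈ Finset.range j, X l ≤ ∑ l ∈ Finset.range (j + 1), x (l * ε) := by
      intro j
      rw [Finset.sum_range_succ']
      have := Finset.sum_le_sum (s := Finset.range j) fun l _ => hXhi l
      have := hx0 ((0 : ℕ) * ε)
      linarith
    cases k with
    | zero => simp [hX0]
    | succ j =>
      have h1 := this j
      rw [Finset.sum_range_succ X]
      have h2 := hXmono (Nat.le_succ j)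
      simp only [Nat.succ_eq_add_one] at h2
      linarith
  have hleft : ∀ k : ℕ, ∫ t in {t | cellOf ε t = k},
      (t * x t - ε * ∑ l ∈ Finset.range (cellOf ε t), x (l * ε)) ∂μ ≤
      q k * (k * ε * X k - ε * ∑ l ∈ Finset.range k, X l) + 2 * ε * (q k * X k) := by
    intro k
    have h1 : ∫ t in {t | cellOf ε t = k},
      (t * x t - ε * ∑ l ∈ Finset.range (cellOf ε t), x (l * ε)) ∂μ ≤
      ∫ t in {t | cellOf ε t = k}, (((k + 1) * ε) * x t - 
        ε * (∑ l ∈ Finset.range k, X l - X k)) ∂μ := by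
      apply integral_mono_ae hIntegL.integrableOn
        ((hxint.integrableOn.const_mul _).sub (integrable_const _))
      filter_upwards [hae k] with t ht
      have h2 := lt_cellOf_mul (t := t) hε
      simp only [Pi.sub_apply, ht.1] at h2 ⊢
      have := mul_le_mul_of_nonneg_left (hsum k) hε.le
      have := mul_le_mul_of_nonneg_right h2.le (hx0 t)
      linarith
    refine h1.trans (le_of_eq ?_)
    rw [integral_sub (hxint.integrableOn.const_mul _) (integrable_const _), integral_const_mul,
      setIntegral_const, smul_eq_mul]
    change (k + 1) * ε * I k - q k * _ = _
    rw [← hqX]; ring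
  have hright : ∀ k : ℕ, ∫ t in {t | cellOf ε t = k}, (y (cellOf ε t) + 2 * ε) * x t ∂μ =
      q k * y k * X k + 2 * ε * (q k * X k) := by
    intro k
    have : ∫ t in {t | cellOf ε t = k}, (y (cellOf ε t) + 2 * ε) * x t ∂μ =
      ∫ t in {t | cellOf ε t = k}, (y k + 2 * ε) * x t ∂μ :=
      setIntegral_congr_fun (measurableSet_cell ε k) (fun t (ht : _ = _) => by simp only [ht])
    rw [this, integral_const_mul]
    change _ * I k = _
    rw [← hqX]; ring
  refine (Finset.sum_le_sum fun k _ => hleft k).trans ?_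
  simp only [hright, Finset.sum_add_distrib]
  rw [abel_psi]
  have := hy X hXmono hX0
  unfold cellPsi at this
  linarith

theorem one_dim_lower {μ : Measure ℝ} [IsProbabilityMeasure μ] {ε h : ℝ} (hε : 0 < ε)
    (hμ : μ (Set.Icc 0 h)ᶜ = 0) (y : ℕ → ℝ) (W : ℕ → ℝ)
    (hW : ∑ k ∈ Finset.range (cellOf ε h + 1), cellMass μ ε k * y k * W k ≤
        ∑ k ∈ Finset.range (cellOf ε h + 1), cellPsi μ ε (cellOf ε h) k * W k) :
    ∫ t, y (cellOf ε t) * W (cellOf ε t) ∂μ ≤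
    ∫ t, (cellOf ε t * ε * W (cellOf ε t) - ε * ∑ l ∈ Finset.range (cellOf ε t), W l) ∂μ := by
  rw [integral_cell hε hμ (fun k => y k * W k),
    integral_cell hε hμ (fun k => k * ε * W k - ε * ∑ l ∈ Finset.range k, W l), abel_psi]
  refine le_trans (le_of_eq ?_) hW
  exact Finset.sum_congr rfl fun k _ => by ring

theorem pi_update_map {n : ℕ} (D : Fin n → Measure ℝ) [∀ i, IsProbabilityMeasure (D i)]
    (i : Fin n) :
    ((Measure.pi D).prod (D i)).map (fun p => Function.update p.1 i p.2) = Measure.pi D := by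
  symm
  have hm : Measurable (fun p : (Fin n → ℝ) × ℝ => Function.update p.1 i p.2) := by
    rw [measurable_pi_iff]
    intro j
    by_cases hj : j = i
    · subst hj; simpa using measurable_snd
    · simp only [Function.update_of_ne hj]; fun_prop
  apply Measure.pi_eq
  intro s hs
  rw [Measure.map_apply hm (MeasurableSet.univ_pi hs)]
  have : (fun p : (Fin n → ℝ) × ℝ => Function.update p.1 i p.2) ⁻¹' (Set.univ.pi s) =
      (Set.univ.pi (Function.update s i Set.univ)) ×ˢ (s i) := by
    ext ⟨v, t⟩
    simp only [Set.mem_preimage, Set.mem_pi, Set.mem_univ, true_imp_iff, Set.mem_prod]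
    constructor
    · intro H
      refine ⟨fun j => ?_, by simpa using H i⟩
      by_cases hj : j = i
      · subst hj; simp
      · simpa [hj] using H j
    · rintro ⟨H, H2⟩ j
      by_cases hj : j = i
      · subst hj; simpa using H2
      · simpa [hj] using H j
  rw [this, Measure.prod_prod, Measure.pi_pi]
  rw [← Finset.mul_prod_erase Finset.univ _ (Finset.mem_univ i),
    ← Finset.mul_prod_erase Finset.univ (fun j => D j (s j)) (Finset.mem_univ i)]
  simp only [Function.update_self, measure_univ, one_mul]
  rw [mul_comm]
  congr 1
  refine Finset.prod_congr rfl fun j hj => ?_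
  rw [Function.update_of_ne (Finset.ne_of_mem_erase hj)]

theorem measurable_update_pair {n : ℕ} (i : Fin n) :
    Measurable (fun p : (Fin n → ℝ) × ℝ => Function.update p.1 i p.2) := by
  rw [measurable_pi_iff]
  intro j
  by_cases hj : j = i
  · subst hj; simpa using measurable_snd
  · simp only [Function.update_of_ne hj]; fun_prop

theorem integral_pi_update_mono {n : ℕ} (D : Fin n → Measure ℝ)
    [∀ i, IsProbabilityMeasure (D i)] (i : Fin n) {f g : (Fin n → ℝ) → ℝ}
    (hf : Integrable f (Measure.pi D)) (hg : Integrable g (Measure.pi D))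
    (hfg : ∀ᵐ v ∂(Measure.pi D), ∫ t, f (Function.update v i t) ∂(D i) ≤
      ∫ t, g (Function.update v i t) ∂(D i)) :
    ∫ v, f v ∂(Measure.pi D) ≤ ∫ v, g v ∂(Measure.pi D) := by
  have hm := (measurable_update_pair i).aemeasurable (μ := (Measure.pi D).prod (D i))
  have key : ∀ f : (Fin n → ℝ) → ℝ, Integrable f (Measure.pi D) →
      Integrable (fun p : (Fin n → ℝ) × ℝ => f (Function.update p.1 i p.2))
        ((Measure.pi D).prod (D i)) ∧
      ∫ v, f v ∂(Measure.pi D) = ∫ v, ∫ t, f (Function.update v i t) ∂(D i) ∂(Measure.pi D) := by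
    intro f hf
    rw [← pi_update_map D i] at hf
    have h1 := hf.comp_aemeasurable hm
    refine ⟨h1, ?_⟩
    conv_lhs => rw [← pi_update_map D i]
    rw [integral_map hm hf.aestronglyMeasurable]
    exact integral_prod _ h1
  obtain ⟨f1, f2⟩ := key f hf
  obtain ⟨g1, g2⟩ := key g hg
  rw [f2, g2]
  exact integral_mono_ae f1.integral_prod_left g1.integral_prod_left hfg

/-- level of buyer `i` at cell index `l` -/
def lvl {n K : ℕ} (r : Fin n → Fin (K + 1) → Fin (K + 1)) (i : Fin n) (l : ℕ) : ℕ :=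
  (r i ⟨min l K, by omega⟩).val

/-- buyer `i` would win with level `L` against cell profile `c` -/
def winsAt {n K : ℕ} (r : Fin n → Fin (K + 1) → Fin (K + 1)) (c : Fin n → ℕ) (i : Fin n)
    (L : ℕ) : Prop :=
  1 ≤ L ∧ (∀ j, j < i → lvl r j (c j) < L) ∧ (∀ j, i < j → lvl r j (c j) ≤ L)

open Classical in
/-- allocation of buyer `i` when his own cell is `l` -/
noncomputable def winAlloc {n K : ℕ} (r : Fin n → Fin (K + 1) → Fin (K + 1)) (c : Fin n → ℕ)
    (i : Fin n) (l : ℕ) : ℝ := if winsAt r c i (lvl r i l) then 1 else 0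

/-- the level mechanism -/
noncomputable def lvlMech {n K : ℕ} (ε : ℝ) (r : Fin n → Fin (K + 1) → Fin (K + 1)) : Mech n where
  alloc v i := winAlloc r (fun j => cellOf ε (v j)) i (cellOf ε (v i))
  pay v i := cellOf ε (v i) * ε * winAlloc r (fun j => cellOf ε (v j)) i (cellOf ε (v i)) -
    ε * ∑ l ∈ Finset.range (cellOf ε (v i)), winAlloc r (fun j => cellOf ε (v j)) i l

theorem winAlloc_zero_or_one {n K : ℕ} (r : Fin n → Fin (K + 1) → Fin (K + 1)) (c : Fin n → ℕ)
    (i : Fin n) (l : ℕ) : winAlloc r c i l = 0 ∨ winAlloc r c i l = 1 := by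
  unfold winAlloc; split_ifs <;> simp

theorem winAlloc_nonneg {n K : ℕ} (r : Fin n → Fin (K + 1) → Fin (K + 1)) (c : Fin n → ℕ)
    (i : Fin n) (l : ℕ) : 0 ≤ winAlloc r c i l := by
  rcases winAlloc_zero_or_one r c i l with h | h <;> simp [h]

theorem winAlloc_le_one {n K : ℕ} (r : Fin n → Fin (K + 1) → Fin (K + 1)) (c : Fin n → ℕ)
    (i : Fin n) (l : ℕ) : winAlloc r c i l ≤ 1 := by
  rcases winAlloc_zero_or_one r c i l with h | h <;> simp [h]

theorem winAlloc_eq_one {n K : ℕ} {r : Fin n → Fin (K + 1) → Fin (K + 1)} {c : Fin n → ℕ}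
    {i : Fin n} {l : ℕ} : winAlloc r c i l = 1 ↔ winsAt r c i (lvl r i l) := by
  unfold winAlloc; split_ifs <;> simp_all

theorem winAlloc_mono_lvl {n K : ℕ} (r : Fin n → Fin (K + 1) → Fin (K + 1)) (c : Fin n → ℕ)
    (i : Fin n) {l l' : ℕ} (h : lvl r i l ≤ lvl r i l') : winAlloc r c i l ≤ winAlloc r c i l' := by
  rcases winAlloc_zero_or_one r c i l with h0 | h0
  · rw [h0]; exact winAlloc_nonneg _ _ _ _
  · rw [h0]
    rw [winAlloc_eq_one] at h0
    refine le_of_eq (Eq.symm ?_)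
    rw [winAlloc_eq_one]
    exact ⟨h0.1.trans h, fun j hj => (h0.2.1 j hj).trans_le h, fun j hj => (h0.2.2 j hj).trans h⟩

theorem lvl_mono {n K : ℕ} {r : Fin n → Fin (K + 1) → Fin (K + 1)} (hr : ∀ i, Monotone (r i))
    (i : Fin n) : Monotone (lvl r i) := by
  intro a b hab
  exact Fin.val_le_of_le (hr i (by simp only [Fin.mk_le_mk]; exact min_le_min_right _ hab))

theorem winAlloc_mono {n K : ℕ} {r : Fin n → Fin (K + 1) → Fin (K + 1)}
    (hr : ∀ i, Monotone (r i)) (c : Fin n → ℕ) (i : Fin n) : Monotone (winAlloc r c i) :=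
  fun _ _ hab => winAlloc_mono_lvl r c i (lvl_mono hr i hab)

theorem winAlloc_congr {n K : ℕ} (r : Fin n → Fin (K + 1) → Fin (K + 1)) {c c' : Fin n → ℕ}
    (i : Fin n) (h : ∀ j, j ≠ i → c j = c' j) (l : ℕ) : winAlloc r c i l = winAlloc r c' i l := by
  have : winsAt r c i (lvl r i l) ↔ winsAt r c' i (lvl r i l) := by
    unfold winsAt
    refine and_congr Iff.rfl (and_congr ?_ ?_)
    · exact forall_congr' fun j => imp_congr_right fun hj => by rw [h j hj.ne]
    · exact forall_congr' fun j => imp_congr_right fun hj => by rw [h j hj.ne']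
  unfold winAlloc
  rw [propext this]

theorem winsAt_unique {n K : ℕ} {r : Fin n → Fin (K + 1) → Fin (K + 1)} {c : Fin n → ℕ}
    {i j : Fin n} (hi : winsAt r c i (lvl r i (c i))) (hj : winsAt r c j (lvl r j (c j))) :
    i = j := by
  rcases lt_trichotomy i j with h | h | h
  · have := hi.2.2 j h
    have := hj.2.1 i h
    omega
  · exact h
  · have := hj.2.2 i h
    have := hi.2.1 j h
    omega

theorem sum_winAlloc_le {n K : ℕ} (r : Fin n → Fin (K + 1) → Fin (K + 1)) (c : Fin n → ℕ) :
    ∑ i, winAlloc r c i (c i) ≤ 1 := by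
  by_cases h : ∃ i, winsAt r c i (lvl r i (c i))
  · obtain ⟨i, hi⟩ := h
    rw [Finset.sum_eq_single i]
    · exact winAlloc_le_one _ _ _ _
    · intro j _ hj
      rcases winAlloc_zero_or_one r c j (c j) with h0 | h0
      · exact h0
      · exact absurd (winsAt_unique (winAlloc_eq_one.1 h0) hi) hj
    · simp
  · push Not at h
    rw [Finset.sum_eq_zero]
    · exact zero_le_one
    · intro j _
      rcases winAlloc_zero_or_one r c j (c j) with h0 | h0
      · exact h0
      · exact absurd (winAlloc_eq_one.1 h0) (h j)

theorem mono_sum_bounds {W : ℕ → ℝ} (hW : Monotone W) {a b : ℕ} (hab : a ≤ b) :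
    ((b : ℝ) - a) * W a ≤ ∑ l ∈ Finset.range b, W l - ∑ l ∈ Finset.range a, W l ∧
    ∑ l ∈ Finset.range b, W l - ∑ l ∈ Finset.range a, W l ≤ ((b : ℝ) - a) * W b := by
  induction b, hab using Nat.le_induction with
  | base => simp
  | succ b hb ih =>
    rw [Finset.sum_range_succ]
    have h1 := hW hb
    have h2 := hW (Nat.le_succ b)
    simp only [Nat.succ_eq_add_one] at h2
    have h3 : (0 : ℝ) ≤ (b : ℝ) - a := sub_nonneg.2 (by exact_mod_cast hb)
    push_cast
    constructor
    · linarith [ih.1]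
    · nlinarith [ih.2]

theorem dsic_1d {W : ℕ → ℝ} (hW : Monotone W) {ε v : ℝ} {k : ℕ} (hε : 0 < ε)
    (h1 : k * ε ≤ v) (h2 : v ≤ (k + 1) * ε) (k' : ℕ) :
    v * W k' - (k' * ε * W k' - ε * ∑ l ∈ Finset.range k', W l) ≤
    v * W k - (k * ε * W k - ε * ∑ l ∈ Finset.range k, W l) := by
  rcases lt_or_ge k k' with h | h
  · have hb := (mono_sum_bounds hW (Nat.succ_le_of_lt h)).2
    rw [Finset.sum_range_succ] at hb
    push_cast at hb
    have h3 := hW h.le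
    have h4 := mul_le_mul_of_nonneg_left hb hε.le
    nlinarith [mul_nonneg (sub_nonneg.2 h2) (sub_nonneg.2 h3)]
  · have hb := (mono_sum_bounds hW h).1
    have h3 := hW h
    have h4 := mul_le_mul_of_nonneg_left hb hε.le
    nlinarith [mul_nonneg (sub_nonneg.2 h1) (sub_nonneg.2 h3)]

theorem lvlMech_pay_bounds {n K : ℕ} {ε : ℝ} (hε : 0 < ε)
    {r : Fin n → Fin (K + 1) → Fin (K + 1)} (hr : ∀ i, Monotone (r i)) (v : Fin n → ℝ)
    (i : Fin n) : 0 ≤ (lvlMech ε r).pay v i ∧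
      (lvlMech ε r).pay v i ≤ cellOf ε (v i) * ε * (lvlMech ε r).alloc v i := by
  simp only [lvlMech]
  set W := winAlloc r (fun j => cellOf ε (v j)) i
  have hW : Monotone W := winAlloc_mono hr _ i
  have := mono_sum_bounds hW (Nat.zero_le (cellOf ε (v i)))
  simp only [Finset.range_zero, Finset.sum_empty, Nat.cast_zero, sub_zero] at this
  have h0 : 0 ≤ ∑ l ∈ Finset.range (cellOf ε (v i)), W l :=
    Finset.sum_nonneg fun l _ => winAlloc_nonneg _ _ _ _
  have h1 := mul_le_mul_of_nonneg_left this.2 hε.le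
  have h2 := mul_nonneg hε.le h0
  constructor <;> linarith

theorem lvlMech_good {n K : ℕ} {ε : ℝ} (hε : 0 < ε)
    {r : Fin n → Fin (K + 1) → Fin (K + 1)} (hr : ∀ i, Monotone (r i)) :
    (lvlMech ε r).Good := by
  refine ⟨?_, ?_, ?_, ?_, ?_⟩
  · intro v
    exact ⟨fun i => ⟨winAlloc_nonneg _ _ _ _, winAlloc_le_one _ _ _ _⟩, sum_winAlloc_le r _⟩
  · intro i v hv v' hv'
    simp only [lvlMech, Function.update_self]
    have hc : ∀ l, winAlloc r (fun j => cellOf ε (Function.update v i v' j)) i l =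
        winAlloc r (fun j => cellOf ε (v j)) i l := by
      intro l
      apply winAlloc_congr
      intro j hj
      rw [Function.update_of_ne hj]
    simp only [hc]
    exact dsic_1d (winAlloc_mono hr _ i) hε (cellOf_mul_le hε (hv i)) (lt_cellOf_mul hε).le _
  · intro v hv i
    have h1 := (lvlMech_pay_bounds hε hr v i).2
    have h2 : 0 ≤ (lvlMech ε r).alloc v i := winAlloc_nonneg _ _ _ _
    have h3 := mul_le_mul_of_nonneg_right (cellOf_mul_le hε (hv i)) h2
    linarith
  · intro i
    have h : Measurable (fun v : Fin n → ℝ => fun j => cellOf ε (v j)) :=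
      measurable_pi_iff.2 fun j => (measurable_cellOf ε).comp (measurable_pi_apply j)
    exact (Measurable.of_discrete (f := fun c : Fin n → ℕ => winAlloc r c i (c i))).comp h
  · intro i
    have h : Measurable (fun v : Fin n → ℝ => fun j => cellOf ε (v j)) :=
      measurable_pi_iff.2 fun j => (measurable_cellOf ε).comp (measurable_pi_apply j)
    exact (Measurable.of_discrete (f := fun c : Fin n → ℕ => c i * ε * winAlloc r c i (c i) -
      ε * ∑ l ∈ Finset.range (c i), winAlloc r c i l)).comp h

theorem lvlMech_total_bounds {n K : ℕ} {ε h : ℝ} (hε : 0 < ε) (hh : 0 ≤ h)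
    {r : Fin n → Fin (K + 1) → Fin (K + 1)} (hr : ∀ i, Monotone (r i)) {v : Fin n → ℝ}
    (hv : ∀ i, v i ∈ Set.Icc 0 h) :
    ∑ i, (lvlMech ε r).pay v i ∈ Set.Icc 0 h := by
  refine ⟨Finset.sum_nonneg fun i _ => (lvlMech_pay_bounds hε hr v i).1, ?_⟩
  have h1 : ∀ i, (lvlMech ε r).pay v i ≤ h * (lvlMech ε r).alloc v i := by
    intro i
    refine (lvlMech_pay_bounds hε hr v i).2.trans ?_
    exact mul_le_mul_of_nonneg_right ((cellOf_mul_le hε (hv i).1).trans (hv i).2)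
      (winAlloc_nonneg _ _ _ _)
  refine (Finset.sum_le_sum fun i _ => h1 i).trans ?_
  rw [← Finset.mul_sum]
  exact mul_le_of_le_one_right hh (sum_winAlloc_le r _)

/-- The allocation nearly maximizes the sum of any level-compatible scores. -/
theorem winner_score {n K : ℕ} {ε : ℝ} (hε : 0 < ε) (r : Fin n → Fin (K + 1) → Fin (K + 1))
    (y : Fin n → ℕ → ℝ)
    (hlo : ∀ i l, (lvl r i l : ℝ) * ε ≤ y i l) (hhi : ∀ i l, y i l ≤ (lvl r i l + 1) * ε)
    (c : Fin n → ℕ) (x : Fin n → ℝ) (hx0 : ∀ i, 0 ≤ x i) (hx1 : ∑ i, x i ≤ 1) :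
    ∑ i, (y i (c i) + 2 * ε) * x i ≤ ∑ i, y i (c i) * winAlloc r c i (c i) + 3 * ε := by
  have hy0 : ∀ i l, 0 ≤ y i l := fun i l => le_trans (by positivity) (hlo i l)
  set R := ∑ i, y i (c i) * winAlloc r c i (c i) with hR
  have hR0 : 0 ≤ R := Finset.sum_nonneg fun i _ => mul_nonneg (hy0 _ _) (winAlloc_nonneg _ _ _ _)
  have hall : ∀ i, y i (c i) ≤ R + ε := by
    by_cases hz : ∀ i, lvl r i (c i) = 0
    · intro i
      have := hhi i (c i)
      rw [hz i] at this
      simp at this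
      linarith
    · push Not at hz
      obtain ⟨i₀, hi₀⟩ := hz
      -- the maximal level, and the first buyer attaining it
      obtain ⟨a, -, ha⟩ := Finset.exists_max_image Finset.univ (fun i => lvl r i (c i))
        ⟨i₀, Finset.mem_univ _⟩
      set S := Finset.univ.filter (fun i => lvl r i (c i) = lvl r a (c a)) with hS
      have hSne : S.Nonempty := ⟨a, by simp [hS]⟩
      set b := S.min' hSne with hb
      have hbS : b ∈ S := S.min'_mem hSne
      have hbl : lvl r b (c b) = lvl r a (c a) := (Finset.mem_filter.1 hbS).2
      have hmax : ∀ j, lvl r j (c j) ≤ lvl r b (c b) := fun j => by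
        rw [hbl]; exact ha j (Finset.mem_univ _)
      have hwin : winsAt r c b (lvl r b (c b)) := by
        refine ⟨?_, ?_, fun j _ => hmax j⟩
        · have := hmax i₀; omega
        · intro j hj
          refine lt_of_le_of_ne (hmax j) fun he => ?_
          have : b ≤ j := S.min'_le j (by simp [hS, he, hbl])
          exact absurd hj (not_lt.2 this)
      have hRb : y b (c b) ≤ R := by
        have := Finset.single_le_sum (f := fun i => y i (c i) * winAlloc r c i (c i))
          (fun i _ => mul_nonneg (hy0 _ _) (winAlloc_nonneg _ _ _ _)) (Finset.mem_univ b)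
        simpa [winAlloc_eq_one.2 hwin] using this
      intro i
      have h1 := hhi i (c i)
      have h2 := hlo b (c b)
      have h3 : (lvl r i (c i) : ℝ) ≤ lvl r b (c b) := by exact_mod_cast hmax i
      nlinarith
  have : ∑ i, (y i (c i) + 2 * ε) * x i ≤ ∑ i, (R + 3 * ε) * x i :=
    Finset.sum_le_sum fun i _ => mul_le_mul_of_nonneg_right (by linarith [hall i]) (hx0 i)
  refine this.trans ?_
  rw [← Finset.mul_sum]
  exact mul_le_of_le_one_right (by positivity) hx1

theorem ae_pi_Icc {n : ℕ} (D : Fin n → Measure ℝ) [∀ i, IsProbabilityMeasure (D i)] {h : ℝ}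
    (hD : ∀ i, D i ((Set.Icc (0 : ℝ) h)ᶜ) = 0) :
    ∀ᵐ v ∂(Measure.pi D), ∀ i, v i ∈ Set.Icc 0 h := by
  rw [ae_all_iff]
  intro i
  exact (measurePreserving_eval D i).quasiMeasurePreserving.ae (ae_mem_Icc (hD i))

theorem mech_mono {n : ℕ} {M : Mech n} (hM : M.Good) (i : Fin n) {v : Fin n → ℝ}
    (hv : ∀ j, 0 ≤ v j) {s t : ℝ} (hs : 0 ≤ s) (hst : s ≤ t) :
    M.alloc (Function.update v i s) i ≤ M.alloc (Function.update v i t) i := by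
  have nn : ∀ a : ℝ, 0 ≤ a → ∀ j, 0 ≤ Function.update v i a j := by
    intro a ha j
    by_cases hj : j = i
    · subst hj; simpa using ha
    · simpa [hj] using hv j
  rcases hst.eq_or_lt with rfl | hlt
  · exact le_rfl
  have h1 := hM.2.1 i _ (nn s hs) t (hs.trans hst)
  have h2 := hM.2.1 i _ (nn t (hs.trans hst)) s hs
  simp only [Function.update_idem, Function.update_self] at h1 h2
  by_contra! hc
  nlinarith

theorem mech_pay_le {n : ℕ} {M : Mech n} (hM : M.Good) {ε : ℝ} (hε : 0 < ε) (i : Fin n)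
    {v : Fin n → ℝ} (hv : ∀ j, 0 ≤ v j) :
    M.pay v i ≤ v i * M.alloc v i -
      ε * ∑ l ∈ Finset.range (cellOf ε (v i)), M.alloc (Function.update v i (l * ε)) i := by
  have nn : ∀ a : ℝ, 0 ≤ a → ∀ j, 0 ≤ Function.update v i a j := by
    intro a ha j
    by_cases hj : j = i
    · subst hj; simpa using ha
    · simpa [hj] using hv j
  set x : ℝ → ℝ := fun t => M.alloc (Function.update v i t) i with hx
  set p : ℝ → ℝ := fun t => M.pay (Function.update v i t) i with hp
  have hIC : ∀ t s, 0 ≤ t → 0 ≤ s → t * x s - p s ≤ t * x t - p t := by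
    intro t s ht hs
    have h1 := hM.2.1 i _ (nn t ht) s hs
    simpa only [Function.update_idem, Function.update_self] using h1
  have hchain : ∀ k : ℕ, ε * ∑ l ∈ Finset.range k, x (l * ε) ≤ (k * ε) * x (k * ε) - p (k * ε) := by
    intro k
    induction k with
    | zero =>
      have := hM.2.2.1 _ (nn 0 le_rfl) i
      simpa [hx, hp] using this
    | succ k ih =>
      rw [Finset.sum_range_succ]
      have := hIC ((k + 1 : ℕ) * ε) (k * ε) (by positivity) (by positivity)
      push_cast at this ⊢
      linarith
  have h1 := hchain (cellOf ε (v i))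
  have h2 := hIC (v i) (cellOf ε (v i) * ε) (hv i) (by positivity)
  have h3 : 0 ≤ x (cellOf ε (v i) * ε) := ((hM.1 _).1 i).1
  have h4 := mul_le_mul_of_nonneg_right (cellOf_mul_le hε (hv i)) h3
  have e1 : x (v i) = M.alloc v i := by simp [hx]
  have e2 : p (v i) = M.pay v i := by simp [hp]
  rw [e1, e2] at h2
  linarith

theorem measurable_sum_range {n : ℕ} (ε : ℝ) (i : Fin n) (f : ℕ → (Fin n → ℝ) → ℝ)
    (hf : ∀ l, Measurable (f l)) :
    Measurable fun v : Fin n → ℝ => ∑ l ∈ Finset.range (cellOf ε (v i)), f l v := by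
  have h1 : Measurable fun p : (Fin n → ℝ) × ℕ => ∑ l ∈ Finset.range p.2, f l p.1 :=
    measurable_from_prod_countable_left fun k => Finset.measurable_sum (Finset.range k) fun l _ => hf l
  exact h1.comp (measurable_id.prodMk ((measurable_cellOf ε).comp (measurable_pi_apply i)))

theorem approx {n : ℕ} {ε h : ℝ} (hε : 0 < ε) (hh : 0 ≤ h) (D : Fin n → Measure ℝ)
    [∀ i, IsProbabilityMeasure (D i)] (hD : ∀ i, D i ((Set.Icc (0 : ℝ) h)ᶜ) = 0) :
    ∃ r : Fin n → Fin (cellOf ε h + 1) → Fin (cellOf ε h + 1), (∀ i, Monotone (r i)) ∧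
      ∀ M : Mech n, M.Good →
        Rev M (Measure.pi D) ≤ Rev (lvlMech ε r) (Measure.pi D) + 3 * ε := by
  set K := cellOf ε h with hK
  have hiso := fun i => isotonic K (cellMass (D i) ε) (cellPsi (D i) ε K) h hh
    (cellMass_nonneg _ _) (cellPsi_le (D i) hε hh)
  choose y hym hy0 hyh hyK hyup hylow using hiso
  set r : Fin n → Fin (K + 1) → Fin (K + 1) := fun i k =>
    ⟨cellOf ε (y i k), Nat.lt_succ_of_le (cellOf_le hε (hyh i k))⟩ with hr
  have hrm : ∀ i, Monotone (r i) := by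
    intro i a b hab
    simp only [hr, Fin.mk_le_mk]
    exact cellOf_le hε (hym i hab)
  have hlvl : ∀ i l, lvl r i l = cellOf ε (y i l) := by
    intro i l
    simp only [lvl, hr]
    rw [← hyK]
  have hlo : ∀ i l, (lvl r i l : ℝ) * ε ≤ y i l := fun i l => by
    rw [hlvl]; exact cellOf_mul_le hε (hy0 i l)
  have hhi : ∀ i l, y i l ≤ (lvl r i l + 1) * ε := fun i l => by
    rw [hlvl]; exact (lt_cellOf_mul hε).le
  refine ⟨r, hrm, ?_⟩
  have hgood := lvlMech_good hε hrm
  have hae := ae_pi_Icc D hD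
  -- gap for the finitely many values of `y i`
  have hgap : ∀ i, ∃ s : ℝ, 0 < s ∧ ∀ j k, y i j < y i k → s ≤ y i k - y i j := by
    intro i
    have hev : ∀ᶠ s in nhdsWithin (0 : ℝ) (Set.Ioi 0), ∀ j k : Fin (K + 1),
        y i j < y i k → s ≤ y i k - y i j := by
      rw [Filter.eventually_all]
      intro j
      rw [Filter.eventually_all]
      intro k
      rw [Filter.eventually_imp_distrib_left]
      intro hjk
      exact nhdsWithin_le_nhds (eventually_le_nhds (sub_pos.2 hjk))
    obtain ⟨s, hs, hs0⟩ := (hev.and self_mem_nhdsWithin).exists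
    refine ⟨s, hs0, fun j k hjk => ?_⟩
    rw [hyK i j, hyK i k] at hjk ⊢
    exact hs ⟨min j K, by omega⟩ ⟨min k K, by omega⟩ hjk
  have hylow' : ∀ i c, ∑ k ∈ Finset.range (K + 1), cellMass (D i) ε k * y i k * winAlloc r c i k ≤
      ∑ k ∈ Finset.range (K + 1), cellPsi (D i) ε K k * winAlloc r c i k := by
    intro i c
    apply hylow i _ (winAlloc_mono hrm c i) (winAlloc_nonneg r c i) (hgap i)
      ⟨ε, hε, ?_⟩ (winAlloc_zero_or_one r c i) ?_
    · intro k hk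
      have h1 := winAlloc_eq_one.1 ((winAlloc_zero_or_one r c i k).resolve_left hk)
      refine le_trans ?_ (hlo i k)
      have : (1 : ℝ) ≤ lvl r i k := by exact_mod_cast h1.1
      nlinarith
    · intro j k hj hk
      by_contra! hc
      have : lvl r i k ≤ lvl r i j := by rw [hlvl, hlvl]; exact cellOf_le hε hc
      have := winAlloc_mono_lvl r c i this
      rw [hj, hk] at this
      linarith
  -- the target quantity
  set G : Fin n → (Fin n → ℝ) → ℝ := fun i v =>
    y i (cellOf ε (v i)) * (lvlMech ε r).alloc v i with hG
  have hcm : ∀ i, Measurable fun v : Fin n → ℝ => y i (cellOf ε (v i)) := fun i =>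
    (Measurable.of_discrete (f := y i)).comp ((measurable_cellOf ε).comp (measurable_pi_apply i))
  have hGint : ∀ i, Integrable (G i) (Measure.pi D) := by
    intro i
    refine Integrable.of_bound (C := h) ((hcm i).mul (hgood.2.2.2.1 i)).aestronglyMeasurable ?_
    refine Filter.Eventually.of_forall fun v => ?_
    have hx := (hgood.1 v).1 i
    rw [Real.norm_eq_abs, abs_of_nonneg (mul_nonneg (hy0 _ _) hx.1)]
    exact (mul_le_of_le_one_right (hy0 _ _) hx.2).trans (hyh _ _)
  have hPint : ∀ i, Integrable (fun v => (lvlMech ε r).pay v i) (Measure.pi D) := by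
    intro i
    refine Integrable.of_bound (C := h) (hgood.2.2.2.2 i).aestronglyMeasurable ?_
    filter_upwards [hae] with v hv
    have h1 := lvlMech_pay_bounds hε hrm v i
    rw [Real.norm_eq_abs, abs_of_nonneg h1.1]
    have h2 := lvlMech_total_bounds hε hh hrm hv
    refine le_trans ?_ h2.2
    exact Finset.single_le_sum (f := fun i => (lvlMech ε r).pay v i)
      (fun j _ => (lvlMech_pay_bounds hε hrm v j).1) (Finset.mem_univ i)
  have hlower : ∑ i, ∫ v, G i v ∂(Measure.pi D) ≤ Rev (lvlMech ε r) (Measure.pi D) := by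
    unfold Rev
    rw [integral_finsetSum _ fun i _ => hPint i]
    refine Finset.sum_le_sum fun i _ => ?_
    refine integral_pi_update_mono D i (hGint i) (hPint i) (Filter.Eventually.of_forall fun v => ?_)
    have hc : ∀ t l, winAlloc r (fun j => cellOf ε (Function.update v i t j)) i l =
        winAlloc r (fun j => cellOf ε (v j)) i l := by
      intro t l
      apply winAlloc_congr
      intro j hj
      rw [Function.update_of_ne hj]
    have := one_dim_lower hε (hD i) (y i) (winAlloc r (fun j => cellOf ε (v j)) i) (hylow' i _)
    simpa only [hG, lvlMech, Function.update_self, hc] using this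
  have hR0 : 0 ≤ Rev (lvlMech ε r) (Measure.pi D) :=
    integral_nonneg fun v => Finset.sum_nonneg fun i _ => (lvlMech_pay_bounds hε hrm v i).1
  intro M hM
  by_cases hInteg : Integrable (fun v => ∑ i, M.pay v i) (Measure.pi D)
  swap
  · have : Rev M (Measure.pi D) = 0 := integral_undef hInteg
    rw [this]; positivity
  set Bd : Fin n → (Fin n → ℝ) → ℝ := fun i v => v i * M.alloc v i -
      ε * ∑ l ∈ Finset.range (cellOf ε (v i)), M.alloc (Function.update v i (l * ε)) i with hBd
  have hxb : ∀ i v, 0 ≤ M.alloc v i ∧ M.alloc v i ≤ 1 := fun i v => (hM.1 v).1 i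
  have hupm : ∀ (i : Fin n) (a : ℝ), Measurable fun v : Fin n → ℝ => Function.update v i a := by
    intro i a
    exact (measurable_update_pair i).comp (measurable_id.prodMk measurable_const)
  have hBint : ∀ i, Integrable (Bd i) (Measure.pi D) := by
    intro i
    refine Integrable.of_bound (C := h) ?_ ?_
    · refine Measurable.aestronglyMeasurable ?_
      refine ((measurable_pi_apply i).mul (hM.2.2.2.1 i)).sub (measurable_const.mul ?_)
      exact measurable_sum_range ε i (fun l v => M.alloc (Function.update v i (l * ε)) i)
        fun l => (hM.2.2.2.1 i).comp (hupm i _)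
    · filter_upwards [hae] with v hv
      have h1 : v i * M.alloc v i ≤ h :=
        (mul_le_of_le_one_right (hv i).1 (hxb i v).2).trans (hv i).2
      have h2 : 0 ≤ v i * M.alloc v i := mul_nonneg (hv i).1 (hxb i v).1
      have h3 : 0 ≤ ∑ l ∈ Finset.range (cellOf ε (v i)), M.alloc (Function.update v i (l * ε)) i :=
        Finset.sum_nonneg fun l _ => (hxb i _).1
      have h4 : ∑ l ∈ Finset.range (cellOf ε (v i)), M.alloc (Function.update v i (l * ε)) i ≤
          cellOf ε (v i) := by
        refine (Finset.sum_le_sum fun l _ => (hxb i _).2).trans ?_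
        simp
      have h5 := mul_le_mul_of_nonneg_left h4 hε.le
      have h6 := mul_nonneg hε.le h3
      have h7 := cellOf_mul_le hε (hv i).1
      have h8 := (hv i).2
      rw [Real.norm_eq_abs, abs_le]
      constructor <;> simp only [hBd] <;> linarith
  set U : Fin n → (Fin n → ℝ) → ℝ := fun i v => (y i (cellOf ε (v i)) + 2 * ε) * M.alloc v i with hU
  have hUint : ∀ i, Integrable (U i) (Measure.pi D) := by
    intro i
    refine Integrable.of_bound (C := h + 2 * ε)
      (((hcm i).add_const _).mul (hM.2.2.2.1 i)).aestronglyMeasurable ?_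
    refine Filter.Eventually.of_forall fun v => ?_
    have h1 : 0 ≤ y i (cellOf ε (v i)) + 2 * ε := add_nonneg (hy0 _ _) (by positivity)
    rw [Real.norm_eq_abs, abs_of_nonneg (mul_nonneg h1 (hxb i v).1)]
    exact (mul_le_of_le_one_right h1 (hxb i v).2).trans (by linarith [hyh i (cellOf ε (v i))])
  have s1 : Rev M (Measure.pi D) ≤ ∑ i, ∫ v, Bd i v ∂(Measure.pi D) := by
    rw [← integral_finsetSum _ fun i _ => hBint i]
    apply integral_mono_ae hInteg (integrable_finsetSum _ fun i _ => hBint i)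
    filter_upwards [hae] with v hv
    exact Finset.sum_le_sum fun i _ => mech_pay_le hM hε i fun j => (hv j).1
  have s2 : ∀ i, ∫ v, Bd i v ∂(Measure.pi D) ≤ ∫ v, U i v ∂(Measure.pi D) := by
    intro i
    refine integral_pi_update_mono D i (hBint i) (hUint i) ?_
    filter_upwards [hae] with v hv
    have hv0 : ∀ j, 0 ≤ v j := fun j => (hv j).1
    have := one_dim_upper hε (hD i) (y i) (hyup i)
      (fun t => M.alloc (Function.update v i t) i)
      ((hM.2.2.2.1 i).comp ((measurable_update_pair i).comp (measurable_const.prodMk measurable_id)))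
      (fun t => (hxb i _).1) (fun t => (hxb i _).2) (fun s t hs hst => mech_mono hM i hv0 hs hst)
    simpa only [hBd, hU, Function.update_self, Function.update_idem] using this
  have s3 : ∑ i, ∫ v, U i v ∂(Measure.pi D) ≤ ∑ i, ∫ v, G i v ∂(Measure.pi D) + 3 * ε := by
    rw [← integral_finsetSum _ fun i _ => hUint i, ← integral_finsetSum _ fun i _ => hGint i]
    have hGs : Integrable (fun v => ∑ i, G i v) (Measure.pi D) :=
      integrable_finsetSum _ fun i _ => hGint i
    have : ∫ v, (∑ i, G i v) ∂(Measure.pi D) + 3 * ε =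
        ∫ v, ((∑ i, G i v) + 3 * ε) ∂(Measure.pi D) := by
      rw [integral_add hGs (integrable_const _)]; simp
    rw [this]
    apply integral_mono (integrable_finsetSum _ fun i _ => hUint i)
      (hGs.add (integrable_const _))
    intro v
    exact winner_score hε r y hlo hhi (fun j => cellOf ε (v j)) (M.alloc v)
      (fun i => (hxb i v).1) (hM.1 v).2
  have s4 := Finset.sum_le_sum fun i (_ : i ∈ Finset.univ) => s2 i
  linarith

theorem hoeffding_upper {Ω : Type*} [MeasurableSpace Ω] (P : Measure Ω) [IsProbabilityMeasure P]
    {f : Ω → ℝ} (hf : Measurable f) {a b h ε : ℝ} (hab : b - a = h) (hh : 0 < h) (hε : 0 < ε)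
    (hb : ∀ᵐ ω ∂P, f ω ∈ Set.Icc a b) {m : ℕ} (hm : 0 < m) :
    (Measure.pi fun _ : Fin m => P).real {s | m * ε ≤ ∑ j, (f (s j) - ∫ ω, f ω ∂P)} ≤
      Real.exp (-(2 * m * ε ^ 2 / h ^ 2)) := by
  have hsub := ProbabilityTheory.hasSubgaussianMGF_of_mem_Icc hf.aemeasurable hb
  have hind := ProbabilityTheory.iIndepFun_pi (μ := fun _ : Fin m => P)
    (X := fun _ ω => f ω - ∫ ω, f ω ∂P) (fun _ => (hf.sub_const _).aemeasurable)
  have hsub' : ∀ j ∈ (Finset.univ : Finset (Fin m)), ProbabilityTheory.HasSubgaussianMGF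
      (fun s : Fin m → Ω => f (s j) - ∫ ω, f ω ∂P) ((‖b - a‖₊ / 2) ^ 2)
      (Measure.pi fun _ : Fin m => P) := by
    intro j _
    refine ProbabilityTheory.HasSubgaussianMGF.of_map (mΩ := inferInstance)
      (X := fun ω => f ω - ∫ ω, f ω ∂P) (Y := fun s : Fin m → Ω => s j) ?_ ?_
    · exact (measurable_pi_apply j).aemeasurable
    · rw [(measurePreserving_eval (fun _ : Fin m => P) j).map_eq]
      exact hsub
  have := ProbabilityTheory.HasSubgaussianMGF.measure_sum_ge_le_of_iIndepFun hind hsub'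
    (ε := m * ε) (by positivity)
  refine this.trans (le_of_eq ?_)
  congr 1
  have hm' : (0 : ℝ) < m := by exact_mod_cast hm
  simp [hab, abs_of_pos hh]
  field_simp

theorem hoeffding_lower {Ω : Type*} [MeasurableSpace Ω] (P : Measure Ω) [IsProbabilityMeasure P]
    {f : Ω → ℝ} (hf : Measurable f) {h ε : ℝ} (hh : 0 < h) (hε : 0 < ε)
    (hb : ∀ᵐ ω ∂P, f ω ∈ Set.Icc 0 h) {m : ℕ} (hm : 0 < m) :
    (Measure.pi fun _ : Fin m => P).real {s | m * ε ≤ ∑ j, (∫ ω, f ω ∂P - f (s j))} ≤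
      Real.exp (-(2 * m * ε ^ 2 / h ^ 2)) := by
  have := hoeffding_upper P (f := fun ω => - f ω) hf.neg (a := -h) (b := 0) (h := h) (by ring)
    hh hε (by filter_upwards [hb] with ω hω; exact ⟨by linarith [hω.2], by linarith [hω.1]⟩) hm
  refine le_trans (le_of_eq ?_) this
  congr 1
  ext s
  simp only [Set.mem_ofPred_eq, integral_neg]
  have : ∀ j, ∫ ω, f ω ∂P - f (s j) = - f (s j) - -∫ ω, f ω ∂P := fun j => by ring
  simp only [this]

theorem card_bound {n K : ℕ} {h ε γ : ℝ} (hn : 1 ≤ n) (hε : 0 < ε) (h3 : 3 * ε ≤ h)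
    (hγ : 0 < γ) (hγ1 : γ < 1) (hK : K * ε ≤ h) {m : ℕ}
    (hm : 10 * h ^ 2 / ε ^ 2 * ((n : ℝ) * h / ε * Real.log ((n : ℝ) * h / ε)
                  + Real.log (1 / γ)) ≤ (m : ℝ)) :
    0 < m ∧ 2 * (((K + 1 : ℕ) : ℝ) ^ (K + 1)) ^ n * Real.exp (-(2 * m * ε ^ 2 / h ^ 2)) ≤ γ := by
  set T := (n : ℝ) * h / ε with hT
  have hh : 0 < h := by linarith
  have hn' : (1 : ℝ) ≤ n := by exact_mod_cast hn
  have hr : 3 ≤ h / ε := by rw [le_div_iff₀ hε]; exact h3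
  have hTe : T = n * (h / ε) := by rw [hT, mul_div_assoc]
  have hT3 : 3 ≤ T := by rw [hTe]; nlinarith
  have hKr : (K : ℝ) ≤ h / ε := by rw [le_div_iff₀ hε]; exact hK
  have hlogT : Real.log 2 ≤ Real.log T := Real.log_le_log (by norm_num) (by linarith)
  have hlog2 : 0 < Real.log 2 := Real.log_pos (by norm_num)
  have hL0 : 0 < T * Real.log T := mul_pos (by linarith) (by linarith)
  have hLγ : 0 ≤ Real.log (1 / γ) := Real.log_nonneg (by rw [le_div_iff₀ hγ]; linarith)
  have hmpos : (0 : ℝ) < m := lt_of_lt_of_le (by positivity) hm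
  refine ⟨by exact_mod_cast hmpos, ?_⟩
  have hm2 : 20 * (T * Real.log T + Real.log (1 / γ)) ≤ 2 * m * ε ^ 2 / h ^ 2 := by
    rw [le_div_iff₀ (by positivity)]
    rw [div_mul_eq_mul_div, div_le_iff₀ (by positivity)] at hm
    nlinarith
  have hKpos : (0 : ℝ) < ((K + 1 : ℕ) : ℝ) := by positivity
  have hcard : 2 * (((K + 1 : ℕ) : ℝ) ^ (K + 1)) ^ n ≤ Real.exp (5 * (T * Real.log T)) := by
    rw [← Real.log_le_iff_le_exp (by positivity), Real.log_mul (by norm_num) (by positivity),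
      Real.log_pow, Real.log_pow]
    have a1 : ((K + 1 : ℕ) : ℝ) ≤ 2 * (h / ε) := by push_cast; linarith
    have a2 : ((K + 1 : ℕ) : ℝ) ≤ T * T := by
      refine a1.trans ?_
      have : h / ε ≤ T := by rw [hTe]; nlinarith
      nlinarith
    have a3 : Real.log ((K + 1 : ℕ) : ℝ) ≤ 2 * Real.log T := by
      refine (Real.log_le_log hKpos a2).trans (le_of_eq ?_)
      rw [Real.log_mul (by linarith) (by linarith)]; ring
    have a4 : (n : ℝ) * ((K + 1 : ℕ) : ℝ) ≤ 2 * T := by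
      rw [hTe]; nlinarith
    have a5 : 0 ≤ Real.log ((K + 1 : ℕ) : ℝ) := Real.log_natCast_nonneg _
    have a6 : (n : ℝ) * ((K + 1 : ℕ) : ℝ) * Real.log ((K + 1 : ℕ) : ℝ) ≤
        2 * T * (2 * Real.log T) := mul_le_mul a4 a3 a5 (by linarith)
    have a7 : Real.log T ≤ T * Real.log T := by nlinarith
    linarith
  calc 2 * (((K + 1 : ℕ) : ℝ) ^ (K + 1)) ^ n * Real.exp (-(2 * m * ε ^ 2 / h ^ 2))
      ≤ Real.exp (5 * (T * Real.log T)) * Real.exp (-(2 * m * ε ^ 2 / h ^ 2)) :=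
        mul_le_mul_of_nonneg_right hcard (Real.exp_pos _).le
    _ = Real.exp (5 * (T * Real.log T) - 2 * m * ε ^ 2 / h ^ 2) := by
        rw [← Real.exp_add]; ring_nf
    _ ≤ Real.exp (- Real.log (1 / γ)) := Real.exp_le_exp.2 (by linarith)
    _ = γ := by rw [one_div, Real.log_inv, neg_neg, Real.exp_log hγ]

theorem ofReal_le_of_compl {Ω : Type*} [MeasurableSpace Ω] (P : Measure Ω)
    [IsProbabilityMeasure P] {γ : ℝ} {S : Set Ω} (hS : P.real Sᶜ ≤ γ) :
    ENNReal.ofReal (1 - γ) ≤ P S := by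
  have h1 : P Set.univ ≤ P S + P Sᶜ := by
    rw [← Set.union_compl_self S]; exact measure_union_le _ _
  rw [measure_univ] at h1
  have h2 : P Sᶜ ≤ ENNReal.ofReal γ := by
    rw [← ofReal_measureReal (measure_ne_top _ _)]
    exact ENNReal.ofReal_le_ofReal hS
  have h3 : (0 : ℝ) ≤ γ := measureReal_nonneg.trans hS
  rw [ENNReal.ofReal_sub _ h3, ENNReal.ofReal_one]
  exact tsub_le_iff_right.2 (h1.trans (by gcongr))

/-- **Additive sample complexity for bounded-support product distributions.**
There is a universal constant `C > 0` such that for all `n ≥ 1`, `h > 0`,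
`ε ∈ (0,h]`, `γ ∈ (0,1)`, there is a learning rule `A` from samples to
measurable DSIC and IR mechanisms such that for every product Borel
distribution `D` on `[0,h]ⁿ`, whenever
`m ≥ C·h²·ε⁻²·(n·h·ε⁻¹·log(nh/ε) + log(1/γ))`, with probability at least `1-γ`
over `m` i.i.d. samples from `D` the learned mechanism has revenue at least
`Opt(D) - C·ε`. -/
theorem bounded_support_additive_sample_complexity :
    ∃ C : ℝ, 0 < C ∧
      ∀ (n : ℕ), 1 ≤ n → ∀ h : ℝ, 0 < h →
      ∀ ε γ : ℝ, ε ∈ Set.Ioc (0 : ℝ) h → γ ∈ Set.Ioo (0 : ℝ) 1 →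
      ∃ A : (m : ℕ) → (Fin m → (Fin n → ℝ)) → Mech n,
        (∀ m s, (A m s).Good) ∧
        ∀ D : Fin n → Measure ℝ, (∀ i, IsProbabilityMeasure (D i)) →
          (∀ i, D i ((Set.Icc (0 : ℝ) h)ᶜ) = 0) →
          ∀ m : ℕ,
            C * h ^ 2 / ε ^ 2 *
                ((n : ℝ) * h / ε * Real.log ((n : ℝ) * h / ε)
                  + Real.log (1 / γ)) ≤ (m : ℝ) →
            ENNReal.ofReal (1 - γ) ≤
              (Measure.pi fun _ : Fin m => Measure.pi D)
                {s | Opt (Measure.pi D) - C * ε ≤ Rev (A m s) (Measure.pi D)} := by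
  refine ⟨10, by norm_num, fun n hn h hh ε γ hε hγ => ?_⟩
  have hε0 : 0 < ε := hε.1
  have hh0 : 0 ≤ h := hh.le
  classical
  let ι := {r : Fin n → Fin (cellOf ε h + 1) → Fin (cellOf ε h + 1) // ∀ i, Monotone (r i)}
  have : Nonempty ι := ⟨⟨fun _ _ => 0, fun _ => monotone_const⟩⟩
  let F : ι → (Fin n → ℝ) → ℝ := fun r v => ∑ i, (lvlMech ε r.1).pay v i
  have hbest : ∀ (m : ℕ) (s : Fin m → (Fin n → ℝ)), ∃ r : ι, ∀ r' : ι,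
      ∑ j, F r' (s j) ≤ ∑ j, F r (s j) := fun m s =>
    Finite.exists_max (fun r : ι => ∑ j, F r (s j))
  choose best hbest using hbest
  refine ⟨fun m s => lvlMech ε (best m s).1, fun m s => lvlMech_good hε0 (best m s).2, ?_⟩
  intro D hDp hD m hm
  have := hDp
  set P := Measure.pi D with hP
  obtain ⟨r₀, hr₀, happ⟩ := approx hε0 hh0 D hD
  have hae := ae_pi_Icc D hD
  have hFm : ∀ r, Measurable (F r) := fun r =>
    Finset.measurable_sum _ fun i _ => (lvlMech_good hε0 r.2).2.2.2.2 i
  have hFb : ∀ r, ∀ᵐ v ∂P, F r v ∈ Set.Icc 0 h := fun r => by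
    filter_upwards [hae] with v hv using lvlMech_total_bounds hε0 hh0 r.2 hv
  have hRev : ∀ r : ι, Rev (lvlMech ε r.1) P = ∫ v, F r v ∂P := fun r => rfl
  have hRev0 : ∀ r : ι, 0 ≤ Rev (lvlMech ε r.1) P := fun r => by
    rw [hRev]
    exact integral_nonneg_of_ae ((hFb r).mono fun v hv => hv.1)
  have hRevh : ∀ r : ι, Rev (lvlMech ε r.1) P ≤ h := fun r => by
    rw [hRev]
    have h1 : ∫ v, F r v ∂P ≤ ∫ _, h ∂P :=
      integral_mono_ae (Integrable.of_mem_Icc 0 h (hFm r).aemeasurable (hFb r))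
        (integrable_const _) ((hFb r).mono fun v hv => hv.2)
    simpa using h1
  have hOpt : Opt P ≤ Rev (lvlMech ε r₀) P + 3 * ε := by
    refine csSup_le ⟨_, lvlMech ε r₀, lvlMech_good hε0 hr₀, rfl⟩ ?_
    rintro x ⟨M, hM, rfl⟩
    exact happ M hM
  apply ofReal_le_of_compl
  by_cases h3 : 3 * ε ≤ h
  swap
  · have hempty : {s : Fin m → (Fin n → ℝ) | Opt P - 10 * ε ≤
        Rev (lvlMech ε (best m s).1) P}ᶜ = ∅ := by
      rw [Set.compl_empty_iff, Set.eq_univ_iff_forall]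
      intro s
      have h1 := hRev0 (best m s)
      have h2 := hRevh ⟨r₀, hr₀⟩
      simp only [Set.mem_ofPred_eq]
      push Not at h3
      dsimp only at h2
      linarith
    rw [hempty]
    simpa using hγ.1.le
  · obtain ⟨hm0, hcb⟩ := card_bound (K := cellOf ε h) hn hε0 h3 hγ.1 hγ.2
      (cellOf_mul_le hε0 hh0) hm
    set E := Real.exp (-(2 * m * ε ^ 2 / h ^ 2)) with hE
    let bad : ι → Set (Fin m → (Fin n → ℝ)) := fun r =>
      {s | m * ε ≤ ∑ j, (F r (s j) - ∫ v, F r v ∂P)} ∪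
      {s | m * ε ≤ ∑ j, (∫ v, F r v ∂P - F r (s j))}
    have hbadm : ∀ r, (Measure.pi fun _ : Fin m => P).real (bad r) ≤ 2 * E := by
      intro r
      refine (measureReal_union_le _ _).trans ?_
      have h1 := hoeffding_upper P (hFm r) (sub_zero h) hh hε0 (hFb r) hm0
      have h2 := hoeffding_lower P (hFm r) hh hε0 (hFb r) hm0
      linarith
    have hsub : {s : Fin m → (Fin n → ℝ) | Opt P - 10 * ε ≤
        Rev (lvlMech ε (best m s).1) P}ᶜ ⊆ ⋃ r, bad r := by
      intro s hs
      by_contra hnb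
      apply hs
      simp only [bad, Set.mem_iUnion, Set.mem_union, Set.mem_ofPred_eq, not_exists, not_or,
        not_le, Finset.sum_sub_distrib, Finset.sum_const, Finset.card_univ, Fintype.card_fin,
        nsmul_eq_mul] at hnb
      have h1 := (hnb (best m s)).1
      have h2 := (hnb ⟨r₀, hr₀⟩).2
      have h4 := hbest m s ⟨r₀, hr₀⟩
      rw [← hRev] at h1 h2
      have hm' : (0 : ℝ) < m := by exact_mod_cast hm0
      have h5 : (m : ℝ) * Rev (lvlMech ε r₀) P ≤
          m * (Rev (lvlMech ε (best m s).1) P + 2 * ε) := by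
        dsimp only at h2
        nlinarith
      have h6 := le_of_mul_le_mul_left h5 hm'
      simp only [Set.mem_ofPred_eq]
      linarith
    refine (measureReal_mono hsub).trans ?_
    refine (measureReal_iUnion_fintype_le _).trans ?_
    refine (Finset.sum_le_sum fun r _ => hbadm r).trans ?_
    rw [Finset.sum_const, nsmul_eq_mul]
    refine le_trans ?_ hcb
    have hc : ((Finset.univ : Finset ι).card : ℝ) ≤
        (((cellOf ε h + 1 : ℕ) : ℝ) ^ (cellOf ε h + 1)) ^ n := by
      have h1 : Fintype.card ι ≤ ((cellOf ε h + 1) ^ (cellOf ε h + 1)) ^ n := by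
        refine (Fintype.card_subtype_le _).trans ?_
        simp
      rw [Finset.card_univ]
      exact_mod_cast h1
    have hE0 : 0 ≤ 2 * E := by positivity
    have := mul_le_mul_of_nonneg_right hc hE0
    linarith
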